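/- Let d ≥ 1, let μ ∈ P_1(ℝ^d) be centered, and let ρ ∈ P_1(ℝ^d) be centered and absolutely continuous with respect to Lebesgue measure. Then T(ρ,μ) ≥ c(μ) · ∫ |x| dρ(x), where c(μ) := (1/(2d)) · inf{ ∫ |⟨y,e⟩ − ℓ| dμ(y) : e ∈ ℝ^d, |e| = 1, ℓ ∈ ℝ }. -/

import Mathlib

open MeasureTheory Real Filter Topology
open scoped ENNReal RealInnerProductSpace

noncomputable section

/-- `d`-dimensional Euclidean space. -/
abbrev Ed (d : ℕ) := EuclideanSpace ℝ (Fin d)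

open Classical in
/-- The entropy `E(ρ) = ∫ f ln f dx` (extended-real-valued, computed as positive part minus
negative part of the integral of `f ln f`, where `f` is the density), and `+∞` if `ρ` is not
absolutely continuous w.r.t. Lebesgue measure. -/
def entropy {d : ℕ} (ρ : Measure (Ed d)) : EReal :=
  if ρ ≪ (volume : Measure (Ed d)) then
    ((∫⁻ x, ENNReal.ofReal ((ρ.rnDeriv volume x).toReal *
        Real.log (ρ.rnDeriv volume x).toReal) : ℝ≥0∞) : EReal)
      - ((∫⁻ x, ENNReal.ofReal (-((ρ.rnDeriv volume x).toReal *
        Real.log (ρ.rnDeriv volume x).toReal)) : ℝ≥0∞) : EReal)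
  else ⊤

/-- The (extended-real-valued) integral `∫ ⟨x,y⟩ dγ(x,y)`: positive part minus negative part. -/
def pairInt {d : ℕ} (γ : Measure (Ed d × Ed d)) : EReal :=
  ((∫⁻ p, ENNReal.ofReal (⟪p.1, p.2⟫ : ℝ) ∂γ : ℝ≥0∞) : EReal)
    - ((∫⁻ p, ENNReal.ofReal (-(⟪p.1, p.2⟫ : ℝ)) ∂γ : ℝ≥0∞) : EReal)

/-- Transport plans: probability measures on the product with marginals `ρ` and `μ`. -/
def Couplings {d : ℕ} (ρ μ : Measure (Ed d)) : Set (Measure (Ed d × Ed d)) :=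
  {γ | IsProbabilityMeasure γ ∧ γ.fst = ρ ∧ γ.snd = μ}

/-- The maximal correlation functional `T(ρ,μ) = sup { ∫⟨x,y⟩ dγ : γ ∈ Π(ρ,μ) }`. -/
def maxCorr {d : ℕ} (ρ μ : Measure (Ed d)) : EReal :=
  ⨆ γ ∈ Couplings ρ μ, pairInt γ

/-- `ρ` has finite first moment. -/
def FirstMoment {d : ℕ} (ρ : Measure (Ed d)) : Prop := Integrable (fun x => ‖x‖) ρ

/-- `ρ` is centered: its barycenter is `0`. -/
def Centered {d : ℕ} (ρ : Measure (Ed d)) : Prop := (∫ x, x ∂ρ) = 0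

/-- Weak convergence of measures: convergence of integrals of bounded continuous functions. -/
def WeakConv {d : ℕ} (ρs : ℕ → Measure (Ed d)) (ρ : Measure (Ed d)) : Prop :=
  ∀ f : BoundedContinuousFunction (Ed d) ℝ,
    Tendsto (fun n => ∫ x, f x ∂(ρs n)) atTop (𝓝 (∫ x, f x ∂ρ))

/-- Convexity for extended-real-valued functions on `Ed d`. -/
def EConvexOn {d : ℕ} (u : Ed d → EReal) : Prop :=
  ∀ x y : Ed d, ∀ a b : ℝ, 0 ≤ a → 0 ≤ b → a + b = 1 →
    u (a • x + b • y) ≤ (a : EReal) * u x + (b : EReal) * u y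

/-- `e^{-t}` for `t ∈ ℝ ∪ {+∞}`, with `e^{-∞} = 0`. -/
def expNegE (t : EReal) : ℝ := if t = ⊤ then 0 else Real.exp (-t.toReal)

/-- The Legendre transform `u*(y) = sup_x (⟨x,y⟩ - u(x))`. -/
def legendre {d : ℕ} (u : Ed d → EReal) (y : Ed d) : EReal :=
  ⨆ x : Ed d, (((⟪x, y⟫ : ℝ) : EReal) - u x)

/-- The essential continuity of a convex l.s.c. function `u : ℝ^d → ℝ ∪ {+∞}`:
`u` tends to `+∞` at `H^{d-1}`-a.e. point of the boundary of its domain. -/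
def EssentiallyContinuous {d : ℕ} (u : Ed d → EReal) : Prop :=
  μH[(d : ℝ) - 1] {x : Ed d | x ∈ frontier {y | u y < ⊤} ∧ u x < ⊤} = 0

open ProbabilityTheory in
lemma exists_quantile (ν : Measure ℝ) [IsProbabilityMeasure ν] {q : ℝ} (h0 : 0 < q) (h1 : q < 1) :
    ∃ ℓ : ℝ, ν (Set.Iio ℓ) ≤ ENNReal.ofReal q ∧ ENNReal.ofReal q ≤ ν (Set.Iic ℓ) := by
  set S : Set ℝ := {t | q ≤ cdf ν t} with hS
  have hne : S.Nonempty :=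
    ((tendsto_cdf_atTop ν).eventually (lt_mem_nhds h1)).exists.imp fun t ht => ht.le
  have hbdd : BddBelow S := by
    obtain ⟨b, hb⟩ := ((tendsto_cdf_atBot ν).eventually (gt_mem_nhds h0)).exists
    refine ⟨b, fun t ht => ?_⟩
    by_contra! hlt
    exact absurd (ht.trans (monotone_cdf ν hlt.le)) (not_le.mpr hb)
  refine ⟨sInf S, ?_, ?_⟩
  · rw [← measure_cdf ν, StieltjesFunction.measure_Iio _ (tendsto_cdf_atBot ν), sub_zero]
    refine ENNReal.ofReal_le_ofReal (le_of_tendsto ((monotone_cdf ν).tendsto_leftLim _) ?_)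
    filter_upwards [self_mem_nhdsWithin] with t ht
    by_contra! hlt
    exact absurd (csInf_le hbdd hlt.le) (not_le.mpr ht)
  · rw [← ofReal_cdf]
    refine ENNReal.ofReal_le_ofReal ?_
    have hc : Tendsto (cdf ν) (𝓝[>] sInf S) (𝓝 (cdf ν (sInf S))) :=
      ((cdf ν).right_continuous _).mono_left (nhdsWithin_mono _ Set.Ioi_subset_Ici_self)
    refine ge_of_tendsto hc ?_
    filter_upwards [self_mem_nhdsWithin] with t ht
    obtain ⟨s, hs, hst⟩ := exists_lt_of_csInf_lt hne ht
    exact le_trans hs (monotone_cdf ν hst.le)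

/-- A probability measure can be cut along a level set of `f` into two pieces of prescribed
masses, the level set itself being shared between the pieces if it carries mass. -/
lemma exists_split_at_level {Ω : Type*} [MeasurableSpace Ω] (μ : Measure Ω) [IsProbabilityMeasure μ]
    {f : Ω → ℝ} (hf : Measurable f) {m n : ℝ≥0∞} (hmn : m + n = 1) (hm : m ≠ 0) (hn : n ≠ 0) :
    ∃ (ℓ : ℝ) (μ₁ μ₂ : Measure Ω), μ₁ + μ₂ = μ ∧ μ₁ Set.univ = m ∧
      (∀ᵐ y ∂μ₁, ℓ ≤ f y) ∧ (∀ᵐ y ∂μ₂, f y ≤ ℓ) := by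
  have hm_top : m ≠ ∞ := fun h => by simp [h] at hmn
  have hn_top : n ≠ ∞ := fun h => by simp [h] at hmn
  have hn_lt : n < 1 := by
    rw [← hmn, add_comm]
    exact ENNReal.lt_add_right hn_top hm
  have := Measure.isProbabilityMeasure_map (μ := μ) hf.aemeasurable
  obtain ⟨ℓ, h₁, h₂⟩ := exists_quantile (μ.map f) (q := n.toReal) (ENNReal.toReal_pos hn hn_top)
    ((ENNReal.toReal_lt_toReal hn_top ENNReal.one_ne_top).mpr hn_lt)
  rw [ENNReal.ofReal_toReal hn_top] at h₁ h₂
  rw [Measure.map_apply hf measurableSet_Iio] at h₁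
  rw [Measure.map_apply hf measurableSet_Iic] at h₂
  set L := f ⁻¹' Set.Iio ℓ
  set E := f ⁻¹' {ℓ}
  set G := f ⁻¹' Set.Ioi ℓ
  have hL : MeasurableSet L := hf measurableSet_Iio
  have hE : MeasurableSet E := hf (measurableSet_singleton ℓ)
  have hG : MeasurableSet G := hf measurableSet_Ioi
  have hLE : Disjoint L E := Set.disjoint_left.mpr fun x hx hx' => ne_of_lt hx hx'
  have hLEG : Disjoint (L ∪ E) G := Set.disjoint_left.mpr fun x hx hx' => by
    rcases hx with hx | hx
    · exact lt_asymm (show f x < ℓ from hx) hx'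
    · exact ne_of_gt (show ℓ < f x from hx') hx
  have hunion : L ∪ E ∪ G = Set.univ := by
    ext x
    rcases lt_trichotomy (f x) ℓ with h | h | h <;> simp [L, E, G, h]
  have hIic : f ⁻¹' Set.Iic ℓ = L ∪ E := by
    ext x
    simp [L, E, le_iff_lt_or_eq]
  have htotal : μ L + μ E + μ G = 1 := by
    rw [← measure_union hLE hE, ← measure_union hLEG hG, hunion, measure_univ]
  rw [hIic, measure_union hLE hE] at h₂
  have hGm : μ G ≤ m := by
    rw [← ENNReal.add_le_add_iff_right hn_top, hmn, ← htotal, add_comm (μ G)]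
    gcongr
  have hmEG : m ≤ μ E + μ G := by
    rw [← ENNReal.add_le_add_iff_right hn_top, hmn, ← htotal, add_comm _ n, ← add_assoc]
    gcongr
  set t : ℝ≥0∞ := (m - μ G) / μ E
  have ht : t ≤ 1 := ENNReal.div_le_of_le_mul (by rw [one_mul]; exact tsub_le_iff_right.mpr hmEG)
  have htE : t * μ E = m - μ G := by
    refine ENNReal.div_mul_cancel' (fun h => ?_) (fun h => absurd h (measure_ne_top μ E))
    rw [h, zero_add] at hmEG
    exact tsub_eq_zero_of_le hmEG
  refine ⟨ℓ, μ.restrict G + t • μ.restrict E, μ.restrict L + (1 - t) • μ.restrict E, ?_, ?_, ?_, ?_⟩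
  · calc μ.restrict G + t • μ.restrict E + (μ.restrict L + (1 - t) • μ.restrict E)
        = μ.restrict L + (t + (1 - t)) • μ.restrict E + μ.restrict G := by rw [add_smul]; abel
      _ = μ := by
        rw [add_tsub_cancel_of_le ht, one_smul, ← Measure.restrict_union hLE hE,
          ← Measure.restrict_union hLEG hG, hunion, Measure.restrict_univ]
  · simp [htE, add_tsub_cancel_of_le hGm]
  · rw [ae_add_measure_iff]
    exact ⟨(ae_restrict_mem hG).mono fun x hx => le_of_lt hx,
      Measure.ae_smul_measure ((ae_restrict_mem hE).mono fun x hx => ge_of_eq hx) t⟩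
  · rw [ae_add_measure_iff]
    exact ⟨(ae_restrict_mem hL).mono fun x hx => le_of_lt hx,
      Measure.ae_smul_measure ((ae_restrict_mem hE).mono fun x hx => le_of_eq hx) (1 - t)⟩

lemma pairInt_eq_integral {d : ℕ} {γ : Measure (Ed d × Ed d)}
    (h : Integrable (fun p : Ed d × Ed d => (⟪p.1, p.2⟫ : ℝ)) γ) :
    pairInt γ = ((∫ p, (⟪p.1, p.2⟫ : ℝ) ∂γ : ℝ) : EReal) := by
  rw [integral_eq_lintegral_pos_part_sub_lintegral_neg_part h, pairInt, EReal.coe_sub,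
    EReal.coe_ennreal_toReal h.lintegral_lt_top.ne, EReal.coe_ennreal_toReal]
  exact h.neg.lintegral_lt_top.ne

section InnerProd

variable {E : Type*} [NormedAddCommGroup E] [InnerProductSpace ℝ E] [MeasurableSpace E]

lemma integral_inner_const [CompleteSpace E] {α : Measure E} (hα : Integrable (fun x => x) α)
    (v : E) : ∫ x, (⟪x, v⟫ : ℝ) ∂α = ⟪∫ x, x ∂α, v⟫ := by
  rw [real_inner_comm, ← integral_inner hα v]
  simp_rw [real_inner_comm]

variable [BorelSpace E] [SecondCountableTopology E]

lemma integrable_inner_prod {α β : Measure E} [SFinite α] [SFinite β]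
    (hα : Integrable (fun x => x) α) (hβ : Integrable (fun x => x) β) :
    Integrable (fun p : E × E => (⟪p.1, p.2⟫ : ℝ)) (α.prod β) := by
  refine (hα.norm.mul_prod hβ.norm).mono' (by fun_prop) (ae_of_all _ fun p => ?_)
  exact norm_inner_le_norm p.1 p.2

lemma integral_inner_prod [CompleteSpace E] {α β : Measure E} [SFinite α] [SFinite β]
    (hα : Integrable (fun x => x) α) (hβ : Integrable (fun x => x) β) :
    ∫ p, (⟪p.1, p.2⟫ : ℝ) ∂(α.prod β) = ⟪∫ x, x ∂α, ∫ y, y ∂β⟫ := by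
  rw [integral_prod _ (integrable_inner_prod hα hβ)]
  simp_rw [integral_inner hβ]
  exact integral_inner_const hα _

/-- A direction maximizing `e ↦ ∫ |⟨x, e⟩| dρ` on the unit sphere is parallel to
`∫ sign ⟨x, e⟩ x dρ`. -/
lemma exists_unit_parallel [FiniteDimensional ℝ E] [Nontrivial E] {ρ : Measure E}
    (hρ : Integrable (fun x => x) ρ) :
    ∃ e : E, ‖e‖ = 1 ∧ (∀ v : E, ‖v‖ = 1 → ∫ x, |(⟪x, v⟫ : ℝ)| ∂ρ ≤ ∫ x, |(⟪x, e⟫ : ℝ)| ∂ρ) ∧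
      (∫ x in {x | (0 : ℝ) < ⟪x, e⟫}, x ∂ρ) - (∫ x in {x | (0 : ℝ) < ⟪x, e⟫}ᶜ, x ∂ρ) =
        (∫ x, |(⟪x, e⟫ : ℝ)| ∂ρ) • e := by
  have hint : ∀ v : E, Integrable (fun x => (⟪x, v⟫ : ℝ)) ρ := fun v => hρ.inner_const v
  set F : E → ℝ := fun v => ∫ x, |(⟪x, v⟫ : ℝ)| ∂ρ with hF
  have hFcont : Continuous F := by
    refine continuous_iff_continuousAt.mpr fun v => ?_
    refine continuousAt_of_dominated (bound := fun x => ‖x‖ * (‖v‖ + 1))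
      (Eventually.of_forall fun w => (hint w).abs.aestronglyMeasurable) ?_
      (hρ.norm.mul_const _) (ae_of_all _ fun x => by fun_prop)
    have hev : ∀ᶠ w in 𝓝 v, ‖w‖ < ‖v‖ + 1 :=
      continuous_norm.continuousAt.eventually (gt_mem_nhds (lt_add_one _))
    filter_upwards [hev] with w hw
    refine ae_of_all _ fun x => ?_
    rw [Real.norm_eq_abs, abs_abs]
    exact (abs_real_inner_le_norm x w).trans (by gcongr)
  obtain ⟨e, he, hmax⟩ := (isCompact_sphere (0 : E) 1).exists_isMaxOn
    (NormedSpace.sphere_nonempty.mpr zero_le_one) hFcont.continuousOn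
  have he : ‖e‖ = 1 := by simpa using he
  have hmax : ∀ v : E, ‖v‖ = 1 → F v ≤ F e := fun v hv => hmax (by simpa using hv)
  refine ⟨e, he, hmax, ?_⟩
  set A : Set E := {x | (0 : ℝ) < ⟪x, e⟫} with hA
  have hAm : MeasurableSet A := measurableSet_lt measurable_const (by fun_prop)
  set S : E := (∫ x in A, x ∂ρ) - ∫ x in Aᶜ, x ∂ρ with hS
  have hinner : ∀ v : E, (⟪S, v⟫ : ℝ) = (∫ x in A, ⟪x, v⟫ ∂ρ) - ∫ x in Aᶜ, ⟪x, v⟫ ∂ρ := fun v => by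
    rw [hS, inner_sub_left, integral_inner_const hρ.integrableOn,
      integral_inner_const hρ.integrableOn]
  have hSe : (⟪S, e⟫ : ℝ) = F e := by
    simp only [hinner, hF]
    rw [← integral_add_compl hAm (hint e).abs, sub_eq_add_neg, ← integral_neg]
    congr 1
    · exact setIntegral_congr_fun hAm fun x hx => (abs_of_pos hx).symm
    · exact setIntegral_congr_fun hAm.compl fun x hx =>
        (abs_of_nonpos (not_lt.mp (show ¬ 0 < ⟪x, e⟫ from hx))).symm
  have hSv : ∀ v : E, (⟪S, v⟫ : ℝ) ≤ F v := fun v => by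
    simp only [hinner, hF]
    rw [← integral_add_compl hAm (hint v).abs, sub_eq_add_neg, ← integral_neg]
    refine add_le_add ?_ ?_
    · exact integral_mono (hint v).integrableOn (hint v).abs.integrableOn fun x => le_abs_self _
    · exact integral_mono (hint v).neg.integrableOn (hint v).abs.integrableOn
        fun x => neg_le_abs _
  rcases eq_or_ne S 0 with h0 | h0
  · rw [h0, inner_zero_left] at hSe
    change S = F e • e
    rw [h0, ← hSe, zero_smul]
  · have hpos : 0 < ‖S‖ := norm_pos_iff.mpr h0
    have hnorm : ‖S‖ ≤ F e := by
      have h1 : ‖(‖S‖⁻¹ • S : E)‖ = 1 := norm_smul_inv_norm h0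
      have h2 := (hSv _).trans (hmax _ h1)
      rwa [real_inner_smul_right, real_inner_self_eq_norm_sq, sq, ← mul_assoc,
        inv_mul_cancel₀ hpos.ne', one_mul] at h2
    have heq : ‖S‖ = F e := le_antisymm hnorm <| by
      simpa [hSe, he] using real_inner_le_norm S e
    have := inner_eq_norm_mul_iff_real.mp
      (show (⟪S, e⟫ : ℝ) = ‖S‖ * ‖e‖ by rw [hSe, he, heq, mul_one])
    rw [he, one_smul] at this
    change S = F e • e
    rw [this, heq]

end InnerProd

lemma EuclideanSpace.norm_le_sum_abs {ι : Type*} [Fintype ι] (x : EuclideanSpace ℝ ι) :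
    ‖x‖ ≤ ∑ i, |x i| := by
  classical
  calc ‖x‖ = ‖∑ i, x i • EuclideanSpace.single i (1 : ℝ)‖ := by
        congr 1
        ext j
        simp [Pi.single_apply]
    _ ≤ ∑ i, |x i| := (norm_sum_le _ _).trans_eq (by simp [norm_smul])

lemma integral_norm_le_of_forall_unit {d : ℕ} {ρ : Measure (Ed d)}
    (hρ : Integrable (fun x => x) ρ) {C : ℝ}
    (hC : ∀ v : Ed d, ‖v‖ = 1 → ∫ x, |(⟪x, v⟫ : ℝ)| ∂ρ ≤ C) :
    ∫ x, ‖x‖ ∂ρ ≤ d * C := by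
  have hint : ∀ i : Fin d, Integrable (fun x : Ed d => |x i|) ρ := fun i => by
    simpa [EuclideanSpace.inner_single_right] using
      (hρ.inner_const (𝕜 := ℝ) (EuclideanSpace.single i (1 : ℝ))).abs
  calc ∫ x, ‖x‖ ∂ρ ≤ ∫ x, ∑ i, |x i| ∂ρ :=
        integral_mono hρ.norm (integrable_finsetSum _ fun i _ => hint i)
          EuclideanSpace.norm_le_sum_abs
    _ = ∑ i, ∫ x, |x i| ∂ρ := integral_finsetSum _ fun i _ => hint i
    _ ≤ ∑ _i : Fin d, C := Finset.sum_le_sum fun i _ => by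
        simpa [EuclideanSpace.inner_single_right] using hC (EuclideanSpace.single i 1) (by simp)
    _ = d * C := by simp

/-- Gluing plans between matching pieces of `ρ` and `μ` bounds the maximal correlation. -/
lemma le_maxCorr_of_split {d : ℕ} {ρ₁ ρ₂ μ₁ μ₂ : Measure (Ed d)}
    [IsFiniteMeasure ρ₁] [IsFiniteMeasure ρ₂] [IsFiniteMeasure μ₁] [IsFiniteMeasure μ₂]
    {m n : ℝ≥0∞} (hmn : m + n = 1) (hm : m ≠ 0) (hn : n ≠ 0)
    (hρ₁ : ρ₁ Set.univ = m) (hρ₂ : ρ₂ Set.univ = n)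
    (hμ₁ : μ₁ Set.univ = m) (hμ₂ : μ₂ Set.univ = n)
    (iρ₁ : Integrable (fun x => x) ρ₁) (iρ₂ : Integrable (fun x => x) ρ₂)
    (iμ₁ : Integrable (fun x => x) μ₁) (iμ₂ : Integrable (fun x => x) μ₂) :
    ((m.toReal⁻¹ * ⟪∫ x, x ∂ρ₁, ∫ y, y ∂μ₁⟫ + n.toReal⁻¹ * ⟪∫ x, x ∂ρ₂, ∫ y, y ∂μ₂⟫ : ℝ) : EReal)
      ≤ maxCorr (ρ₁ + ρ₂) (μ₁ + μ₂) := by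
  have hm_top : m ≠ ∞ := fun h => by simp [h] at hmn
  have hn_top : n ≠ ∞ := fun h => by simp [h] at hmn
  set γ : Measure (Ed d × Ed d) := m⁻¹ • ρ₁.prod μ₁ + n⁻¹ • ρ₂.prod μ₂ with hγ
  have hfst : γ.fst = ρ₁ + ρ₂ := by
    rw [hγ, Measure.fst, Measure.map_add _ _ measurable_fst, Measure.map_smul, Measure.map_smul,
      Measure.map_fst_prod, Measure.map_fst_prod, hμ₁, hμ₂, smul_smul, smul_smul,
      ENNReal.inv_mul_cancel hm hm_top, ENNReal.inv_mul_cancel hn hn_top, one_smul, one_smul]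
  have hsnd : γ.snd = μ₁ + μ₂ := by
    rw [hγ, Measure.snd, Measure.map_add _ _ measurable_snd, Measure.map_smul, Measure.map_smul,
      Measure.map_snd_prod, Measure.map_snd_prod, hρ₁, hρ₂, smul_smul, smul_smul,
      ENNReal.inv_mul_cancel hm hm_top, ENNReal.inv_mul_cancel hn hn_top, one_smul, one_smul]
  have hprob : IsProbabilityMeasure γ := ⟨by
    rw [← Measure.fst_univ, hfst, Measure.add_apply, hρ₁, hρ₂, hmn]⟩
  have i₁ := (integrable_inner_prod iρ₁ iμ₁).smul_measure (ENNReal.inv_ne_top.mpr hm)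
  have i₂ := (integrable_inner_prod iρ₂ iμ₂).smul_measure (ENNReal.inv_ne_top.mpr hn)
  refine le_trans (le_of_eq ?_) (le_iSup₂ (f := fun γ _ => pairInt γ) γ ⟨hprob, hfst, hsnd⟩)
  rw [pairInt_eq_integral (i₁.add_measure i₂), integral_add_measure i₁ i₂, integral_smul_measure,
    integral_smul_measure, integral_inner_prod iρ₁ iμ₁, integral_inner_prod iρ₂ iμ₂,
    ENNReal.toReal_inv, ENNReal.toReal_inv, smul_eq_mul, smul_eq_mul]

/-- If `f` has mean zero, and `μ₁`, `μ₂` live above and below the level `ℓ`, then `∫ |f - ℓ|` is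
controlled by the integral of `f` over the upper piece. -/
lemma integral_abs_sub_le_of_split {Ω : Type*} [MeasurableSpace Ω] {μ₁ μ₂ : Measure Ω}
    [IsFiniteMeasure μ₁] [IsFiniteMeasure μ₂] {f : Ω → ℝ} {ℓ : ℝ}
    (i₁ : Integrable f μ₁) (i₂ : Integrable f μ₂)
    (h₁ : ∀ᵐ y ∂μ₁, ℓ ≤ f y) (h₂ : ∀ᵐ y ∂μ₂, f y ≤ ℓ)
    (hmean : ∫ y, f y ∂μ₁ + ∫ y, f y ∂μ₂ = 0)
    (hmass : μ₁.real Set.univ + μ₂.real Set.univ = 1)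
    (hpos₁ : 0 < μ₁.real Set.univ) (hpos₂ : 0 < μ₂.real Set.univ) :
    ∫ y, |f y - ℓ| ∂(μ₁ + μ₂) ≤
      ((μ₁.real Set.univ)⁻¹ + (μ₂.real Set.univ)⁻¹) * ∫ y, f y ∂μ₁ := by
  have e₁ : ∫ y, |f y - ℓ| ∂μ₁ = ∫ y, f y ∂μ₁ - μ₁.real Set.univ * ℓ := by
    rw [integral_congr_ae (h₁.mono fun y hy => abs_of_nonneg (sub_nonneg.mpr hy)),
      integral_sub i₁ (integrable_const ℓ), integral_const, smul_eq_mul]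
  have e₂ : ∫ y, |f y - ℓ| ∂μ₂ = μ₂.real Set.univ * ℓ - ∫ y, f y ∂μ₂ := by
    rw [integral_congr_ae (h₂.mono fun y hy => abs_of_nonpos (sub_nonpos.mpr hy)), integral_neg,
      integral_sub i₂ (integrable_const ℓ), integral_const, smul_eq_mul, neg_sub]
  have p₁ : 0 ≤ ∫ y, |f y - ℓ| ∂μ₁ := integral_nonneg fun _ => abs_nonneg _
  have p₂ : 0 ≤ ∫ y, |f y - ℓ| ∂μ₂ := integral_nonneg fun _ => abs_nonneg _
  have hadd : ∫ y, |f y - ℓ| ∂(μ₁ + μ₂) = ∫ y, |f y - ℓ| ∂μ₁ + ∫ y, |f y - ℓ| ∂μ₂ :=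
    integral_add_measure (i₁.sub (integrable_const ℓ)).abs (i₂.sub (integrable_const ℓ)).abs
  rw [hadd]
  generalize μ₁.real Set.univ = m at *
  generalize μ₂.real Set.univ = n at *
  generalize ∫ y, |f y - ℓ| ∂μ₁ = P at *
  generalize ∫ y, |f y - ℓ| ∂μ₂ = Q at *
  generalize ∫ y, f y ∂μ₁ = a at *
  have ha : a = n * P + m * Q := by
    linear_combination m * hmean - n * e₁ - m * e₂ - a * hmass
  have hsum : m⁻¹ + n⁻¹ = (m * n)⁻¹ := by
    field_simp
    linarith
  rw [hsum, inv_mul_eq_div, le_div_iff₀ (mul_pos hpos₁ hpos₂), ha]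
  have hm : m ≤ 1 := by linarith
  have hn : n ≤ 1 := by linarith
  nlinarith [mul_nonneg (mul_nonneg hpos₂.le p₁) (sub_nonneg.mpr hm),
    mul_nonneg (mul_nonneg hpos₁.le p₂) (sub_nonneg.mpr hn)]

/-- lower bound `T(ρ,μ) ≥ c(μ) ∫|x| dρ` for centered absolutely continuous `ρ`. -/
theorem maxCorr_lower_bound {d : ℕ} (hd : 1 ≤ d)
    (μ : Measure (Ed d)) [IsProbabilityMeasure μ] (hμ1 : FirstMoment μ) (hμc : Centered μ)
    (ρ : Measure (Ed d)) [IsProbabilityMeasure ρ] (hρ1 : FirstMoment ρ) (hρc : Centered ρ)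
    (hac : ρ ≪ (volume : Measure (Ed d))) :
    (((1 / (2 * (d : ℝ))) *
        sInf {r : ℝ | ∃ e : Ed d, ∃ ℓ : ℝ, ‖e‖ = 1 ∧ r = ∫ y, |(⟪y, e⟫ : ℝ) - ℓ| ∂μ} *
        ∫ x, ‖x‖ ∂ρ : ℝ) : EReal) ≤ maxCorr ρ μ := by
  have : Nonempty (Fin d) := ⟨⟨0, hd⟩⟩
  have iμ : Integrable (fun y => y) μ := (integrable_norm_iff (by fun_prop)).mp hμ1
  have iρ : Integrable (fun x => x) ρ := (integrable_norm_iff (by fun_prop)).mp hρ1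
  obtain ⟨e, he, hmax, hpar⟩ := exists_unit_parallel iρ
  have hnorm := integral_norm_le_of_forall_unit iρ hmax
  set F : ℝ := ∫ x, |(⟪x, e⟫ : ℝ)| ∂ρ
  set A : Set (Ed d) := {x | (0 : ℝ) < ⟪x, e⟫}
  have hA : MeasurableSet A := measurableSet_lt measurable_const (by fun_prop)
  have hXadd : (∫ x in A, x ∂ρ) + ∫ x in Aᶜ, x ∂ρ = 0 := by
    rw [integral_add_compl hA iρ, hρc]
  have hX : (∫ x in A, x ∂ρ) = (F / 2) • e := by
    have h2 : (2 : ℝ) • (∫ x in A, x ∂ρ) = F • e := by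
      rw [← hpar, two_smul, eq_neg_of_add_eq_zero_right hXadd, sub_neg_eq_add]
    rw [div_eq_inv_mul, mul_smul, ← h2, smul_smul]
    norm_num
  have hρpos : 0 < ∫ x, ‖x‖ ∂ρ := by
    refine lt_of_le_of_ne (integral_nonneg fun _ => norm_nonneg _) fun h0 => ?_
    rw [eq_comm, integral_eq_zero_iff_of_nonneg (fun _ => norm_nonneg _) hρ1] at h0
    have hzero : ∀ᵐ x ∂ρ, x = 0 := h0.mono fun x hx => norm_eq_zero.mp hx
    have hne : ∀ᵐ x ∂ρ, x ≠ 0 := hac.ae_le (ae_iff.mpr (by simp))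
    obtain ⟨x, hx, hx'⟩ := (hzero.and hne).exists
    exact hx' hx
  have hdpos : (0 : ℝ) < d := by exact_mod_cast hd
  have hFpos : 0 < F := pos_of_mul_pos_right (hρpos.trans_le hnorm) hdpos.le
  have hX0 : (∫ x in A, x ∂ρ) ≠ 0 := by
    rw [hX]
    exact smul_ne_zero (by positivity) (norm_ne_zero_iff.mp (by simp [he]))
  have hm : ρ A ≠ 0 := fun h => hX0 (by rw [Measure.restrict_eq_zero.mpr h, integral_zero_measure])
  have hn : ρ Aᶜ ≠ 0 := fun h => hX0 (by
    rwa [Measure.restrict_eq_zero.mpr h, integral_zero_measure, add_zero] at hXadd)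
  have hmn : ρ A + ρ Aᶜ = 1 := by rw [measure_add_measure_compl hA, measure_univ]
  obtain ⟨ℓ, μ₁, μ₂, hμ, hμ₁, h₁, h₂⟩ := exists_split_at_level μ
    (f := fun y => (⟪y, e⟫ : ℝ)) (by fun_prop) hmn hm hn
  have hle₁ : μ₁ ≤ μ := hμ ▸ Measure.le_add_right le_rfl
  have hle₂ : μ₂ ≤ μ := hμ ▸ Measure.le_add_left le_rfl
  have := isFiniteMeasure_of_le μ hle₁
  have := isFiniteMeasure_of_le μ hle₂
  have iμ₁ := iμ.mono_measure hle₁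
  have iμ₂ := iμ.mono_measure hle₂
  have hμ₂ : μ₂ Set.univ = ρ Aᶜ := by
    rw [← ENNReal.add_right_inj (measure_ne_top ρ A), hmn, ← hμ₁, ← Measure.add_apply, hμ,
      measure_univ]
  have hYadd : (∫ y, y ∂μ₁) + ∫ y, y ∂μ₂ = 0 := by
    rw [← integral_add_measure iμ₁ iμ₂, hμ, hμc]
  have hT := le_maxCorr_of_split (ρ₁ := ρ.restrict A) (ρ₂ := ρ.restrict Aᶜ) hmn hm hn
    (by simp) (by simp) hμ₁ hμ₂ iρ.integrableOn iρ.integrableOn iμ₁ iμ₂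
  rw [Measure.restrict_add_restrict_compl hA, hμ] at hT
  refine le_trans (EReal.coe_le_coe_iff.mpr ?_) hT
  have hr₁ : μ₁.real Set.univ = (ρ A).toReal := by rw [Measure.real, hμ₁]
  have hr₂ : μ₂.real Set.univ = (ρ Aᶜ).toReal := by rw [Measure.real, hμ₂]
  have habs := integral_abs_sub_le_of_split (iμ₁.inner_const e) (iμ₂.inner_const e) h₁ h₂
    (by rw [integral_inner_const iμ₁, integral_inner_const iμ₂, ← inner_add_left, hYadd,
      inner_zero_left])
    (by rw [hr₁, hr₂, ← ENNReal.toReal_add (measure_ne_top _ _) (measure_ne_top _ _), hmn,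
      ENNReal.toReal_one])
    (by rw [hr₁]; exact ENNReal.toReal_pos hm (measure_ne_top _ _))
    (by rw [hr₂]; exact ENNReal.toReal_pos hn (measure_ne_top _ _))
  rw [hμ, hr₁, hr₂, integral_inner_const iμ₁, real_inner_comm] at habs
  set c := sInf {r : ℝ | ∃ e : Ed d, ∃ ℓ : ℝ, ‖e‖ = 1 ∧ r = ∫ y, |(⟪y, e⟫ : ℝ) - ℓ| ∂μ}
  have hlb : ∀ r ∈ {r : ℝ | ∃ e : Ed d, ∃ ℓ : ℝ, ‖e‖ = 1 ∧ r = ∫ y, |(⟪y, e⟫ : ℝ) - ℓ| ∂μ},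
      0 ≤ r := by
    rintro r ⟨v, k, -, rfl⟩
    exact integral_nonneg fun _ => abs_nonneg _
  have hc0 : 0 ≤ c := Real.sInf_nonneg hlb
  have hc : c ≤ ∫ y, |(⟪y, e⟫ : ℝ) - ℓ| ∂μ := csInf_le ⟨0, hlb⟩ ⟨e, ℓ, he, rfl⟩
  rw [eq_neg_of_add_eq_zero_right hXadd, eq_neg_of_add_eq_zero_right hYadd, inner_neg_neg, hX,
    real_inner_smul_left, ← add_mul]
  calc 1 / (2 * (d : ℝ)) * c * ∫ x, ‖x‖ ∂ρ
      ≤ 1 / (2 * (d : ℝ)) * c * (d * F) := by gcongr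
    _ = F / 2 * c := by field_simp
    _ ≤ F / 2 * (((ρ A).toReal⁻¹ + (ρ Aᶜ).toReal⁻¹) * ⟪e, ∫ y, y ∂μ₁⟫) := by
        gcongr
        exact hc.trans habs
    _ = _ := by ring
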